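/- If the coin process X has one-point spectrum, i.e., the spectral sup-entropy H̄(X) and spectral inf-entropy H_(X) both coincide with the entropy rate H(X) > 0, then for any target process Y the interval algorithm is asymptotically optimal for the overflow-probability criterion: R*_int(X,Y) = R*(X,Y) = H̄(Y)/H(X). -/

import Mathlib

open MeasureTheory Filter
open scoped ENNReal Classical

noncomputable section

namespace RNG

variable {𝒳 𝒴 : Type*}

/-- The length-`m` prefix of an infinite sequence, as a tuple. -/
def pre (ω : ℕ → 𝒳) (m : ℕ) : Fin m → 𝒳 := fun i => ω i

/-- The length-`m` prefix of an infinite sequence, as a list. -/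
def preL (ω : ℕ → 𝒳) (m : ℕ) : List 𝒳 := (List.range m).map ω

/-- `P_{X^m}(x^m)` : the probability of the cylinder set of a finite string `x^m`,
for a process with law `μ`. -/
def cylP [MeasurableSpace 𝒳] (μ : Measure (ℕ → 𝒳)) {m : ℕ} (x : Fin m → 𝒳) : ℝ :=
  (μ {ω | ∀ i : Fin m, ω i = x i}).toReal

/-- Validity (exact generation) of an algorithm `φ` (given as a full-tree function on finite
coin strings, `none` playing the role of `⊥`): for every target value `y`, the probability
that the algorithm terminates with output `y` equals `PY y`. -/
def Valid {B : Type*} [MeasurableSpace 𝒳] (μ : Measure (ℕ → 𝒳)) (PY : B → ℝ)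
    (φ : List 𝒳 → Option B) : Prop :=
  ∀ y : B,
    (μ {ω | ∃ i : ℕ, φ (preL ω i) = some y ∧ ∀ j < i, φ (preL ω j) = none}).toReal = PY y

/-- Strict lexicographic order on strings. -/
def lexLt [LT 𝒳] {m : ℕ} (x' x : Fin m → 𝒳) : Prop :=
  ∃ i : Fin m, (∀ j : Fin m, j < i → x' j = x j) ∧ x' i < x i

/-- The subinterval of `[0,1)` assigned to the string `x` by the interval algorithm:
strings are arranged in lexicographic order, `x` receiving an interval of length `P x`. -/
def itv [LT 𝒳] [Fintype 𝒳] {m : ℕ} (P : (Fin m → 𝒳) → ℝ) (x : Fin m → 𝒳) : Set ℝ :=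
  Set.Ico (∑ x' ∈ Finset.univ.filter (fun x' => lexLt x' x), P x')
    ((∑ x' ∈ Finset.univ.filter (fun x' => lexLt x' x), P x') + P x)

/-- The interval algorithm generating `Y^n` (target law `ν`) from the coin process `μ`
has stopped after at most `m` coin symbols on the sample `ω`, i.e. the coin interval
`I_{x^m}` is contained in some target interval `J_{y^n}`. -/
def IntStopped [LinearOrder 𝒳] [Fintype 𝒳] [LinearOrder 𝒴] [Fintype 𝒴]
    [MeasurableSpace 𝒳] [MeasurableSpace 𝒴]
    (μ : Measure (ℕ → 𝒳)) (ν : Measure (ℕ → 𝒴)) (n m : ℕ) (ω : ℕ → 𝒳) : Prop :=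
  ∃ y : Fin n → 𝒴, itv (fun x : Fin m → 𝒳 => cylP μ x) (pre ω m)
      ⊆ itv (fun y' : Fin n → 𝒴 => cylP ν y') y

/-- A rate `R` is achievable by the interval algorithm:
`Pr(T_n > nR) → 0` (the stopping time `T_n` is `ℕ`-valued, so `T_n > nR ↔ T_n > ⌊nR⌋`). -/
def IntAchievable [LinearOrder 𝒳] [Fintype 𝒳] [LinearOrder 𝒴] [Fintype 𝒴]
    [MeasurableSpace 𝒳] [MeasurableSpace 𝒴]
    (μ : Measure (ℕ → 𝒳)) (ν : Measure (ℕ → 𝒴)) (R : ℝ) : Prop :=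
  0 ≤ R ∧ Tendsto (fun n : ℕ =>
      (μ {ω | ¬ IntStopped μ ν n ⌊(n : ℝ) * R⌋₊ ω}).toReal) atTop (nhds 0)

/-- `R⋆_int(X,Y)` : the infimum rate achievable by the interval algorithm. -/
def Rint [LinearOrder 𝒳] [Fintype 𝒳] [LinearOrder 𝒴] [Fintype 𝒴]
    [MeasurableSpace 𝒳] [MeasurableSpace 𝒴]
    (μ : Measure (ℕ → 𝒳)) (ν : Measure (ℕ → 𝒴)) : ℝ :=
  sInf {R : ℝ | IntAchievable μ ν R}

/-- A rate `R` is achievable by some sequence of valid algorithms: for each `n` there is a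
valid algorithm `φ n` generating `Y^n` and `Pr(T_n > nR) → 0`. -/
def Achievable [MeasurableSpace 𝒳] [MeasurableSpace 𝒴]
    (μ : Measure (ℕ → 𝒳)) (ν : Measure (ℕ → 𝒴)) (R : ℝ) : Prop :=
  0 ≤ R ∧ ∃ φ : (n : ℕ) → List 𝒳 → Option (Fin n → 𝒴),
    (∀ n : ℕ, Valid μ (fun y : Fin n → 𝒴 => cylP ν y) (φ n)) ∧
    Tendsto (fun n : ℕ =>
      (μ {ω | ∀ i ≤ ⌊(n : ℝ) * R⌋₊, φ n (preL ω i) = none}).toReal) atTop (nhds 0)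

/-- `R⋆(X,Y)` : the infimum rate achievable over all valid algorithms. -/
def Rstar [MeasurableSpace 𝒳] [MeasurableSpace 𝒴]
    (μ : Measure (ℕ → 𝒳)) (ν : Measure (ℕ → 𝒴)) : ℝ :=
  sInf {R : ℝ | Achievable μ ν R}

/-- The expected stopping time `E[T_n]` of the interval algorithm, via `E[T] = ∑_m Pr(T>m)`. -/
def intAvgT [LinearOrder 𝒳] [Fintype 𝒳] [LinearOrder 𝒴] [Fintype 𝒴]
    [MeasurableSpace 𝒳] [MeasurableSpace 𝒴]
    (μ : Measure (ℕ → 𝒳)) (ν : Measure (ℕ → 𝒴)) (n : ℕ) : ℝ≥0∞ :=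
  ∑' m : ℕ, μ {ω | ¬ IntStopped μ ν n m ω}

/-- A rate `L` is average achievable by the interval algorithm: `limsup E[T_n]/n ≤ L`. -/
def IntAvgAchievable [LinearOrder 𝒳] [Fintype 𝒳] [LinearOrder 𝒴] [Fintype 𝒴]
    [MeasurableSpace 𝒳] [MeasurableSpace 𝒴]
    (μ : Measure (ℕ → 𝒳)) (ν : Measure (ℕ → 𝒴)) (L : ℝ≥0∞) : Prop :=
  limsup (fun n : ℕ => intAvgT μ ν n / (n : ℝ≥0∞)) atTop ≤ L

/-- `L⋆_int(X,Y)` : the infimum average achievable rate of the interval algorithm. -/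
def Lint [LinearOrder 𝒳] [Fintype 𝒳] [LinearOrder 𝒴] [Fintype 𝒴]
    [MeasurableSpace 𝒳] [MeasurableSpace 𝒴]
    (μ : Measure (ℕ → 𝒳)) (ν : Measure (ℕ → 𝒴)) : ℝ≥0∞ :=
  sInf {L : ℝ≥0∞ | IntAvgAchievable μ ν L}

/-- A rate `L` is average achievable by some sequence of valid algorithms. -/
def AvgAchievable [MeasurableSpace 𝒳] [MeasurableSpace 𝒴]
    (μ : Measure (ℕ → 𝒳)) (ν : Measure (ℕ → 𝒴)) (L : ℝ≥0∞) : Prop :=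
  ∃ φ : (n : ℕ) → List 𝒳 → Option (Fin n → 𝒴),
    (∀ n : ℕ, Valid μ (fun y : Fin n → 𝒴 => cylP ν y) (φ n)) ∧
    limsup (fun n : ℕ =>
      (∑' m : ℕ, μ {ω | ∀ i ≤ m, φ n (preL ω i) = none}) / (n : ℝ≥0∞)) atTop ≤ L

/-- `L⋆(X,Y)` : the infimum average achievable rate over all valid algorithms. -/
def Lstar [MeasurableSpace 𝒳] [MeasurableSpace 𝒴]
    (μ : Measure (ℕ → 𝒳)) (ν : Measure (ℕ → 𝒴)) : ℝ≥0∞ :=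
  sInf {L : ℝ≥0∞ | AvgAchievable μ ν L}

/-- The spectral sup-entropy `H̄(X)`: the event `(1/m) log(1/P_{X^m}(X^m)) ≥ λ` is
`P_{X^m}(X^m) ≤ 2^{-mλ}`. -/
def specSup [MeasurableSpace 𝒳] (μ : Measure (ℕ → 𝒳)) : ℝ :=
  sInf {lam : ℝ | Tendsto (fun m : ℕ =>
    (μ {ω | cylP μ (pre ω m) ≤ (2 : ℝ) ^ (-((m : ℝ) * lam))}).toReal) atTop (nhds 0)}

/-- The spectral inf-entropy `H̲(X)`: the event `(1/m) log(1/P_{X^m}(X^m)) ≤ λ` is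
`P_{X^m}(X^m) ≥ 2^{-mλ}`. -/
def specInf [MeasurableSpace 𝒳] (μ : Measure (ℕ → 𝒳)) : ℝ :=
  sSup {lam : ℝ | Tendsto (fun m : ℕ =>
    (μ {ω | (2 : ℝ) ^ (-((m : ℝ) * lam)) ≤ cylP μ (pre ω m)}).toReal) atTop (nhds 0)}

/-- The (sup-)entropy rate `H(X) = limsup (1/m) H(X^m)`. -/
def entRate [MeasurableSpace 𝒳] [Fintype 𝒳] (μ : Measure (ℕ → 𝒳)) : ℝ :=
  limsup (fun m : ℕ =>
    (∑ x : Fin m → 𝒳, cylP μ x * Real.logb 2 (1 / cylP μ x)) / (m : ℝ)) atTop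

/-- Upper-tail condition: `Pr((1/m) log(1/P_{X^m}(X^m)) ≥ H̄(X)+δ) ≤ K/m²` eventually. -/
def UpperTail [MeasurableSpace 𝒳] (μ : Measure (ℕ → 𝒳)) : Prop :=
  ∀ δ : ℝ, 0 < δ → ∃ (K : ℝ) (m₀ : ℕ), ∀ m : ℕ, m₀ ≤ m →
    (μ {ω | cylP μ (pre ω m) ≤ (2 : ℝ) ^ (-((m : ℝ) * (specSup μ + δ)))}).toReal
      ≤ K / (m : ℝ) ^ 2

/-- Lower-tail condition: `Pr((1/m) log(1/P_{X^m}(X^m)) ≤ H̲(X)−δ) ≤ K/m²` eventually. -/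
def LowerTail [MeasurableSpace 𝒳] (μ : Measure (ℕ → 𝒳)) : Prop :=
  ∀ δ : ℝ, 0 < δ → ∃ (K : ℝ) (m₀ : ℕ), ∀ m : ℕ, m₀ ≤ m →
    (μ {ω | (2 : ℝ) ^ (-((m : ℝ) * (specInf μ - δ))) ≤ cylP μ (pre ω m)}).toReal
      ≤ K / (m : ℝ) ^ 2

/-- The finite-dimensional distributions of a Markov chain with initial distribution `q`
and transition matrix `W` (`W x x'` is the transition probability from `x` to `x'`). -/
def markovP (q : 𝒳 → ℝ) (W : 𝒳 → 𝒳 → ℝ) : (m : ℕ) → (Fin m → 𝒳) → ℝ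
  | 0, _ => 1
  | m + 1, x => q (x 0) * ∏ i : Fin m, W (x i.castSucc) (x i.succ)

/-- `μ` is the law of the Markov chain with initial distribution `q` and transition matrix `W`. -/
def IsMarkovMeasure [MeasurableSpace 𝒳] (μ : Measure (ℕ → 𝒳)) (q : 𝒳 → ℝ)
    (W : 𝒳 → 𝒳 → ℝ) : Prop :=
  ∀ (m : ℕ) (x : Fin m → 𝒳), cylP μ x = markovP q W m x

/-- `W` is a (row-)stochastic transition matrix. -/
def IsTransMat [Fintype 𝒳] (W : 𝒳 → 𝒳 → ℝ) : Prop :=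
  (∀ x x', 0 ≤ W x x') ∧ ∀ x, ∑ x', W x x' = 1

/-- Irreducibility: any state reaches any other in some `k ≥ 1` steps. -/
def IrreducibleMat [Fintype 𝒳] [DecidableEq 𝒳] (W : Matrix 𝒳 𝒳 ℝ) : Prop :=
  ∀ x x' : 𝒳, ∃ k : ℕ, 1 ≤ k ∧ 0 < (W ^ k) x x'

/-- `π` is a stationary distribution of `W`. -/
def IsStationary [Fintype 𝒳] (π : 𝒳 → ℝ) (W : 𝒳 → 𝒳 → ℝ) : Prop :=
  (∀ x, 0 ≤ π x) ∧ (∑ x, π x = 1) ∧ ∀ x, ∑ x', π x' * W x' x = π x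

/-- `q` is a probability distribution (initial distribution). -/
def IsInitial [Fintype 𝒳] (q : 𝒳 → ℝ) : Prop :=
  (∀ x, 0 ≤ q x) ∧ ∑ x, q x = 1

/-- The entropy rate `H^W(X) = Σ_{x',x} π(x') W(x|x') log (1/W(x|x'))` of a stationary
Markov chain. -/
def matEnt [Fintype 𝒳] (π : 𝒳 → ℝ) (W : 𝒳 → 𝒳 → ℝ) : ℝ :=
  ∑ x' : 𝒳, ∑ x : 𝒳, π x' * W x' x * Real.logb 2 (1 / W x' x)

/-- The weight `w(ξ) = Pr(Y_1 ∈ 𝒴_ξ)` of the irreducible class `ξ` under the initial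
distribution `q`, where `c` assigns to each state its class. -/
def wgt [Fintype 𝒴] {r : ℕ} (c : 𝒴 → Fin r) (q : 𝒴 → ℝ) (ξ : Fin r) : ℝ :=
  ∑ y ∈ Finset.univ.filter (fun y => c y = ξ), q y

/-- The binary entropy function (base 2). -/
def binEnt (t : ℝ) : ℝ := t * Real.logb 2 (1 / t) + (1 - t) * Real.logb 2 (1 / (1 - t))

end RNG

open RNG

namespace RNG

section Cylinders

variable {α : Type*} [MeasurableSpace α] (μ : Measure (ℕ → α))

lemma measurable_pre (m : ℕ) : Measurable (fun ω : ℕ → α => pre ω m) :=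
  measurable_pi_lambda _ fun i => measurable_pi_apply (i : ℕ)

lemma cylP_nonneg {m : ℕ} (x : Fin m → α) : 0 ≤ cylP μ x := ENNReal.toReal_nonneg

variable [Fintype α] [DiscreteMeasurableSpace α]

lemma cylP_eq_map_real {m : ℕ} (x : Fin m → α) :
    cylP μ x = (μ.map (fun ω => pre ω m)).real {x} := by
  rw [map_measureReal_apply (measurable_pre m) (measurableSet_singleton x)]
  simp only [cylP, Measure.real]
  congr 2
  ext ω
  simp [pre, funext_iff]

variable [IsProbabilityMeasure μ]

lemma toReal_measure_pre {m : ℕ} (p : (Fin m → α) → Prop) [DecidablePred p] :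
    (μ {ω | p (pre ω m)}).toReal = ∑ x with p x, cylP μ x := by
  have := Measure.isProbabilityMeasure_map (μ := μ) (measurable_pre (α := α) m).aemeasurable
  simp only [cylP_eq_map_real]
  rw [sum_measureReal_singleton,
    map_measureReal_apply (measurable_pre m) (Finset.measurableSet _)]
  simp [Measure.real]

lemma sum_cylP (m : ℕ) : ∑ x : Fin m → α, cylP μ x = 1 := by
  simpa using (toReal_measure_pre μ (m := m) (fun _ => True)).symm

lemma cylP_le_one {m : ℕ} (x : Fin m → α) : cylP μ x ≤ 1 := by
  rw [← sum_cylP μ m]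
  exact Finset.single_le_sum (fun y _ => cylP_nonneg μ y) (Finset.mem_univ x)

end Cylinders

section Spectrum

variable {α : Type*} [Fintype α] [MeasurableSpace α] [DiscreteMeasurableSpace α]
  (μ : Measure (ℕ → α)) [IsProbabilityMeasure μ]

lemma toReal_mono_of_imp {Ω : Type*} [MeasurableSpace Ω] (P : Measure Ω) [IsProbabilityMeasure P]
    {p q : Ω → Prop} (h : ∀ ω, p ω → q ω) : (P {ω | p ω}).toReal ≤ (P {ω | q ω}).toReal :=
  measureReal_mono (μ := P) (fun ω hω => h ω hω)

lemma specSup_set_nonneg {lam : ℝ} (h : Tendsto (fun m : ℕ =>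
    (μ {ω | cylP μ (pre ω m) ≤ (2 : ℝ) ^ (-((m : ℝ) * lam))}).toReal) atTop (nhds 0)) :
    0 ≤ lam := by
  by_contra! hlam
  have h1 : ∀ m : ℕ,
      (μ {ω | cylP μ (pre ω m) ≤ (2 : ℝ) ^ (-((m : ℝ) * lam))}).toReal = 1 := by
    intro m
    have : {ω | cylP μ (pre ω m) ≤ (2 : ℝ) ^ (-((m : ℝ) * lam))} = Set.univ := by
      refine Set.eq_univ_of_forall fun ω => (cylP_le_one μ _).trans ?_
      refine Real.one_le_rpow one_le_two ?_
      nlinarith [m.cast_nonneg (α := ℝ)]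
    simp [this]
  simp only [h1] at h
  exact one_ne_zero (tendsto_nhds_unique tendsto_const_nhds h)

lemma specSup_nonneg : 0 ≤ specSup μ :=
  Real.sInf_nonneg fun _ h => specSup_set_nonneg μ h

lemma specSup_le {lam : ℝ} (h : Tendsto (fun m : ℕ =>
    (μ {ω | cylP μ (pre ω m) ≤ (2 : ℝ) ^ (-((m : ℝ) * lam))}).toReal) atTop (nhds 0)) :
    specSup μ ≤ lam :=
  csInf_le ⟨0, fun _ h => specSup_set_nonneg μ h⟩ h

lemma specSup_set_nonempty : {lam : ℝ | Tendsto (fun m : ℕ =>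
    (μ {ω | cylP μ (pre ω m) ≤ (2 : ℝ) ^ (-((m : ℝ) * lam))}).toReal) atTop (nhds 0)}.Nonempty := by
  obtain ⟨k, hk⟩ : ∃ k : ℕ, (Fintype.card α : ℝ) < 2 ^ k :=
    ⟨_, by exact_mod_cast Nat.lt_two_pow_self⟩
  refine ⟨k, ?_⟩
  have hlim : Tendsto (fun m : ℕ => ((Fintype.card α : ℝ) / 2 ^ k) ^ m) atTop (nhds 0) :=
    tendsto_pow_atTop_nhds_zero_of_lt_one (by positivity) ((div_lt_one (by positivity)).2 hk)
  refine squeeze_zero (fun _ => ENNReal.toReal_nonneg) (fun m => ?_) hlim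
  rw [toReal_measure_pre μ (fun x : Fin m → α => cylP μ x ≤ (2 : ℝ) ^ (-((m : ℝ) * k)))]
  calc ∑ x : Fin m → α with cylP μ x ≤ (2 : ℝ) ^ (-((m : ℝ) * k)), cylP μ x
      ≤ ∑ x : Fin m → α with cylP μ x ≤ (2 : ℝ) ^ (-((m : ℝ) * k)), (2 : ℝ) ^ (-((m : ℝ) * k)) :=
        Finset.sum_le_sum fun x hx => (Finset.mem_filter.1 hx).2
    _ ≤ ∑ x : Fin m → α, (2 : ℝ) ^ (-((m : ℝ) * k)) :=
        Finset.sum_le_sum_of_subset_of_nonneg (Finset.filter_subset _ _)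
          fun _ _ _ => by positivity
    _ = ((Fintype.card α : ℝ) / 2 ^ k) ^ m := by
        rw [Finset.sum_const, Finset.card_univ, Fintype.card_fun, Fintype.card_fin, nsmul_eq_mul,
          Real.rpow_neg two_pos.le, div_pow, div_eq_mul_inv, ← pow_mul, mul_comm k m,
          ← Real.rpow_natCast 2 (m * k)]
        push_cast
        rfl

lemma tendsto_of_specSup_lt {lam : ℝ} (h : specSup μ < lam) : Tendsto (fun m : ℕ =>
    (μ {ω | cylP μ (pre ω m) ≤ (2 : ℝ) ^ (-((m : ℝ) * lam))}).toReal) atTop (nhds 0) := by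
  obtain ⟨l, hl, hlt⟩ := exists_lt_of_csInf_lt (specSup_set_nonempty μ) h
  refine squeeze_zero (fun _ => ENNReal.toReal_nonneg) (fun m => ?_) hl
  refine toReal_mono_of_imp μ fun ω hω => hω.trans ?_
  gcongr
  exact one_le_two

lemma tendsto_of_lt_specInf {lam : ℝ} (h : lam < specInf μ) : Tendsto (fun m : ℕ =>
    (μ {ω | (2 : ℝ) ^ (-((m : ℝ) * lam)) ≤ cylP μ (pre ω m)}).toReal) atTop (nhds 0) := by
  have hne : {lam : ℝ | Tendsto (fun m : ℕ =>
      (μ {ω | (2 : ℝ) ^ (-((m : ℝ) * lam)) ≤ cylP μ (pre ω m)}).toReal)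
        atTop (nhds 0)}.Nonempty := by
    refine ⟨-1, tendsto_const_nhds.congr' ?_⟩
    filter_upwards [eventually_ge_atTop 1] with m hm
    have : {ω | (2 : ℝ) ^ (-((m : ℝ) * (-1))) ≤ cylP μ (pre ω m)} = ∅ := by
      refine Set.eq_empty_of_forall_notMem fun ω hω => ?_
      have h1 : (1 : ℝ) < (2 : ℝ) ^ (-((m : ℝ) * (-1))) := by
        refine Real.one_lt_rpow one_lt_two ?_
        have : (1 : ℝ) ≤ m := by exact_mod_cast hm
        linarith
      exact absurd (h1.trans_le hω) (cylP_le_one μ _).not_gt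
    rw [this]
    simp
  obtain ⟨l, hl, hlt⟩ := exists_lt_of_lt_csSup hne h
  refine squeeze_zero (fun _ => ENNReal.toReal_nonneg) (fun m => ?_) hl
  refine toReal_mono_of_imp μ fun ω hω => le_trans ?_ hω
  gcongr
  exact one_le_two

end Spectrum

section Intervals

variable {α : Type*} [LinearOrder α] {m : ℕ}

lemma lexLt_irrefl (x : Fin m → α) : ¬ lexLt x x := fun ⟨_, _, h⟩ => lt_irrefl _ h

lemma lexLt_trans {x y z : Fin m → α} (hxy : lexLt x y) (hyz : lexLt y z) : lexLt x z := by
  obtain ⟨i, hi, hi'⟩ := hxy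
  obtain ⟨j, hj, hj'⟩ := hyz
  rcases lt_trichotomy i j with h | rfl | h
  · exact ⟨i, fun k hk => (hi k hk).trans (hj k (hk.trans h)), by rwa [← hj i h]⟩
  · exact ⟨i, fun k hk => (hi k hk).trans (hj k hk), hi'.trans hj'⟩
  · exact ⟨j, fun k hk => (hi k (hk.trans h)).trans (hj k hk), by rwa [hi j h]⟩

lemma lexLt_or_lexLt_of_ne {x y : Fin m → α} (h : x ≠ y) : lexLt x y ∨ lexLt y x := by
  obtain ⟨i, hi, hmin⟩ := WellFounded.has_min (wellFounded_lt (α := Fin m)) {i | x i ≠ y i}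
    (Function.ne_iff.1 h)
  have heq : ∀ j < i, x j = y j := fun j hj => by
    by_contra hne
    exact hmin j hne hj
  rcases lt_or_gt_of_ne hi with hlt | hlt
  · exact .inl ⟨i, heq, hlt⟩
  · exact .inr ⟨i, fun j hj => (heq j hj).symm, hlt⟩

variable [Fintype α] {P : (Fin m → α) → ℝ}

/-- The left endpoint of `itv P x`. -/
def itvLo (P : (Fin m → α) → ℝ) (x : Fin m → α) : ℝ :=
  ∑ x' ∈ Finset.univ.filter (fun x' => lexLt x' x), P x'

lemma itv_eq (P : (Fin m → α) → ℝ) (x : Fin m → α) :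
    itv P x = Set.Ico (itvLo P x) (itvLo P x + P x) := rfl

lemma itvLo_add (P : (Fin m → α) → ℝ) (x : Fin m → α) :
    itvLo P x + P x = ∑ x' with (lexLt x' x ∨ x' = x), P x' := by
  rw [Finset.filter_or, Finset.sum_union, itvLo]
  · congr 1
    simp [Finset.sum_filter]
  · rw [Finset.disjoint_filter]
    rintro y - hy rfl
    exact lexLt_irrefl _ hy

lemma itvLo_add_le (hP : ∀ x, 0 ≤ P x) {x y : Fin m → α} (h : lexLt x y) :
    itvLo P x + P x ≤ itvLo P y := by
  rw [itvLo_add]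
  refine Finset.sum_le_sum_of_subset_of_nonneg (fun z hz => ?_) fun _ _ _ => hP _
  simp only [Finset.mem_filter, Finset.mem_univ, true_and] at hz ⊢
  rcases hz with hz | rfl
  exacts [lexLt_trans hz h, h]

lemma disjoint_itv (hP : ∀ x, 0 ≤ P x) {x y : Fin m → α} (h : x ≠ y) :
    Disjoint (itv P x) (itv P y) := by
  rw [itv_eq, itv_eq, Set.disjoint_left]
  rintro u ⟨h1, h2⟩ ⟨h3, h4⟩
  rcases lexLt_or_lexLt_of_ne h with h | h <;> linarith [itvLo_add_le hP h]

lemma itv_subset_Ico (hP : ∀ x, 0 ≤ P x) (h1 : ∑ x, P x = 1) (x : Fin m → α) :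
    itv P x ⊆ Set.Ico 0 1 := by
  rw [itv_eq]
  refine Set.Ico_subset_Ico (Finset.sum_nonneg fun _ _ => hP _) ?_
  rw [itvLo_add, ← h1]
  exact Finset.sum_le_sum_of_subset_of_nonneg (Finset.filter_subset _ _) fun _ _ _ => hP _

lemma volume_real_itv (hP : ∀ x, 0 ≤ P x) (x : Fin m → α) : volume.real (itv P x) = P x := by
  rw [itv_eq, Real.volume_real_Ico_of_le (by linarith [hP x])]
  ring

lemma measurableSet_itv (x : Fin m → α) : MeasurableSet (itv P x) := measurableSet_Ico

lemma volume_itv_ne_top (x : Fin m → α) : volume (itv P x) ≠ ⊤ := by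
  rw [itv_eq]; exact measure_Ico_lt_top.ne

lemma volume_real_biUnion_itv (hP : ∀ x, 0 ≤ P x) (S : Finset (Fin m → α)) :
    volume.real (⋃ x ∈ S, itv P x) = ∑ x ∈ S, P x := by
  rw [measureReal_biUnion_finset (fun x _ y _ hxy => disjoint_itv hP hxy)
    (fun x _ => measurableSet_itv x) (fun x _ => volume_itv_ne_top x)]
  exact Finset.sum_congr rfl fun x _ => volume_real_itv hP x

/-- The strings whose intervals lie inside a given target interval carry no more mass than it. -/
lemma sum_itv_subset_le {β : Type*} [LinearOrder β] [Fintype β] {n : ℕ} {Q : (Fin n → β) → ℝ}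
    (hP : ∀ x, 0 ≤ P x) (hQ : ∀ y, 0 ≤ Q y) (y : Fin n → β) :
    ∑ x with itv P x ⊆ itv Q y, P x ≤ Q y := by
  rw [← volume_real_biUnion_itv hP, ← volume_real_itv hQ y]
  refine measureReal_mono ?_ (volume_itv_ne_top y)
  exact Set.iUnion₂_subset fun x hx => (Finset.mem_filter.1 hx).2

lemma sum_itv_disjoint_le {β : Type*} [LinearOrder β] [Fintype β] {n : ℕ} {Q : (Fin n → β) → ℝ}
    (hP : ∀ x, 0 ≤ P x) (hP1 : ∑ x, P x = 1) (hQ : ∀ y, 0 ≤ Q y) (hQ1 : ∑ y, Q y = 1)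
    (D : Finset (Fin n → β)) :
    ∑ x with (∀ y ∈ D, Disjoint (itv P x) (itv Q y)), P x ≤ ∑ y ∈ Dᶜ, Q y := by
  set S := Finset.univ.filter fun x => ∀ y ∈ D, Disjoint (itv P x) (itv Q y) with hS
  have hSsub : (⋃ x ∈ S, itv P x) ⊆ Set.Ico 0 1 :=
    Set.iUnion₂_subset fun x _ => itv_subset_Ico hP hP1 x
  have hDsub : (⋃ y ∈ D, itv Q y) ⊆ Set.Ico 0 1 :=
    Set.iUnion₂_subset fun x _ => itv_subset_Ico hQ hQ1 x
  have hdisj : Disjoint (⋃ x ∈ S, itv P x) (⋃ y ∈ D, itv Q y) := by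
    simp only [Set.disjoint_iUnion_left, Set.disjoint_iUnion_right]
    exact fun y hy x hx => (Finset.mem_filter.1 hx).2 y hy
  have hunit : volume (Set.Ico (0 : ℝ) 1) ≠ ⊤ := measure_Ico_lt_top.ne
  have h := measureReal_mono (Set.union_subset hSsub hDsub) hunit
  rw [measureReal_union hdisj (Finset.measurableSet_biUnion _ fun y _ => measurableSet_itv y)
    (measure_ne_top_of_subset hSsub hunit) (measure_ne_top_of_subset hDsub hunit),
    volume_real_biUnion_itv hP, volume_real_biUnion_itv hQ,
    Real.volume_real_Ico_of_le zero_le_one] at h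
  linarith [Finset.sum_add_sum_compl D Q]

lemma sum_mem_itv_le (hP : ∀ x, 0 ≤ P x) {t : ℝ} (ht : 0 ≤ t) (u : ℝ) :
    ∑ x with (P x ≤ t ∧ u ∈ itv P x), P x ≤ t := by
  set S := Finset.univ.filter fun x => P x ≤ t ∧ u ∈ itv P x with hS
  have hcard : S.card ≤ 1 := Finset.card_le_one.2 fun x hx y hy => by
    by_contra hxy
    exact Set.disjoint_left.1 (disjoint_itv hP hxy) (Finset.mem_filter.1 hx).2.2
      (Finset.mem_filter.1 hy).2.2
  calc ∑ x ∈ S, P x ≤ S.card • t :=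
        Finset.sum_le_card_nsmul _ _ _ fun x hx => (Finset.mem_filter.1 hx).2.1
    _ ≤ 1 • t := nsmul_le_nsmul_left ht hcard
    _ = t := one_nsmul t

lemma itv_mem_endpoint {β : Type*} [LinearOrder β] [Fintype β] {n : ℕ} {Q : (Fin n → β) → ℝ}
    {x : Fin m → α} {y : Fin n → β} (hsub : ¬ itv P x ⊆ itv Q y)
    (hmeet : ¬ Disjoint (itv P x) (itv Q y)) :
    itvLo Q y ∈ itv P x ∨ itvLo Q y + Q y ∈ itv P x := by
  obtain ⟨u, hu, hu'⟩ := Set.not_subset.1 hsub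
  obtain ⟨v, hv, hv'⟩ := Set.not_disjoint_iff.1 hmeet
  simp only [itv_eq, Set.mem_Ico, not_and_or, not_le, not_lt] at *
  rcases hu' with h | h
  · left; constructor <;> linarith
  · right; constructor <;> linarith

/-- The mass of the strings whose interval is contained in no target interval is bounded by
the mass of the long intervals, the mass of the target strings outside `D`, and twice the
cardinality of `D` times the length of the short intervals. -/
lemma sum_not_itv_subset_le {β : Type*} [LinearOrder β] [Fintype β] {n : ℕ}
    {Q : (Fin n → β) → ℝ} (hP : ∀ x, 0 ≤ P x) (hP1 : ∑ x, P x = 1) (hQ : ∀ y, 0 ≤ Q y)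
    (hQ1 : ∑ y, Q y = 1) (D : Finset (Fin n → β)) {t : ℝ} (ht : 0 ≤ t) :
    ∑ x with ¬ (∃ y, itv P x ⊆ itv Q y), P x ≤
      ∑ x with t ≤ P x, P x + ∑ y ∈ Dᶜ, Q y + D.card * (2 * t) := by
  have key : ∀ x, (if ¬ (∃ y, itv P x ⊆ itv Q y) then P x else 0) ≤
      (if t ≤ P x then P x else 0) +
      (if (∀ y ∈ D, Disjoint (itv P x) (itv Q y)) then P x else 0) +
      ∑ y ∈ D, ((if P x ≤ t ∧ itvLo Q y ∈ itv P x then P x else 0) +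
        (if P x ≤ t ∧ itvLo Q y + Q y ∈ itv P x then P x else 0)) := by
    intro x
    have hite : ∀ (p : Prop) [Decidable p], 0 ≤ if p then P x else 0 := fun p _ => by
      split_ifs
      exacts [hP x, le_rfl]
    have hnn : ∀ y ∈ D, 0 ≤ ((if P x ≤ t ∧ itvLo Q y ∈ itv P x then P x else 0) +
        (if P x ≤ t ∧ itvLo Q y + Q y ∈ itv P x then P x else 0)) :=
      fun y _ => add_nonneg (hite _) (hite _)
    have hsum := Finset.sum_nonneg hnn
    by_cases hbad : ∃ y, itv P x ⊆ itv Q y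
    · rw [if_neg (not_not.2 hbad)]
      exact add_nonneg (add_nonneg (hite _) (hite _)) hsum
    rw [if_pos hbad]
    by_cases ht' : t ≤ P x
    · rw [if_pos ht']
      linarith [hite (∀ y ∈ D, Disjoint (itv P x) (itv Q y))]
    by_cases hD : ∀ y ∈ D, Disjoint (itv P x) (itv Q y)
    · rw [if_pos hD]
      linarith [hite (t ≤ P x)]
    push Not at hD ht'
    obtain ⟨y, hy, hmeet⟩ := hD
    have hterm : P x ≤ ((if P x ≤ t ∧ itvLo Q y ∈ itv P x then P x else 0) +
        (if P x ≤ t ∧ itvLo Q y + Q y ∈ itv P x then P x else 0)) := by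
      rcases itv_mem_endpoint (fun h => hbad ⟨y, h⟩) hmeet with h | h
      · rw [if_pos ⟨ht'.le, h⟩]
        linarith [hite (P x ≤ t ∧ itvLo Q y + Q y ∈ itv P x)]
      · rw [if_pos (⟨ht'.le, h⟩ : P x ≤ t ∧ itvLo Q y + Q y ∈ itv P x)]
        linarith [hite (P x ≤ t ∧ itvLo Q y ∈ itv P x)]
    linarith [hite (t ≤ P x), hite (∀ y ∈ D, Disjoint (itv P x) (itv Q y)),
      Finset.single_le_sum hnn hy]
  have h := Finset.sum_le_sum fun x (_ : x ∈ Finset.univ) => key x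
  rw [Finset.sum_add_distrib, Finset.sum_add_distrib, Finset.sum_comm] at h
  simp only [Finset.sum_add_distrib, ← Finset.sum_filter] at h
  have h2 : ∀ f : (Fin n → β) → ℝ,
      ∑ y ∈ D, ∑ x with (P x ≤ t ∧ f y ∈ itv P x), P x ≤ D.card * t := fun f => by
    rw [← nsmul_eq_mul]
    exact Finset.sum_le_card_nsmul _ _ _ fun y _ => sum_mem_itv_le hP ht _
  have h3 := h2 (itvLo Q)
  have h4 := h2 (fun y => itvLo Q y + Q y)
  linarith [sum_itv_disjoint_le hP hP1 hQ hQ1 D]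

end Intervals

section Algorithms

variable {α β : Type*} [MeasurableSpace α] (μ : Measure (ℕ → α)) [IsProbabilityMeasure μ]

/-- A valid algorithm stopping within `m` coin symbols on a coin string of probability at least
`s` outputs a target string of probability at least `s`. -/
lemma sum_lt_le_of_valid {B : Type*} [Fintype B] {Q : B → ℝ} (hQ1 : ∑ y, Q y = 1)
    {φ : List α → Option B} (hφ : Valid μ Q φ) (m : ℕ) (s : ℝ) :
    ∑ y with Q y < s, Q y ≤ (μ {ω | ∀ i ≤ m, φ (preL ω i) = none}).toReal +
      (μ {ω | cylP μ (pre ω m) < s}).toReal := by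
  set E : B → Set (ℕ → α) := fun y =>
    {ω | ∃ i : ℕ, φ (preL ω i) = some y ∧ ∀ j < i, φ (preL ω j) = none} with hE
  have hEQ : ∀ y, μ.real (E y) = Q y := hφ
  have hcover : (Set.univ : Set (ℕ → α)) ⊆ ({ω | ∀ i ≤ m, φ (preL ω i) = none} ∪
      {ω | cylP μ (pre ω m) < s}) ∪ ⋃ y ∈ Finset.univ.filter (fun y => ¬ Q y < s), E y := by
    intro ω _
    by_cases h1 : ∀ i ≤ m, φ (preL ω i) = none
    · exact .inl (.inl h1)
    by_cases h2 : cylP μ (pre ω m) < s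
    · exact .inl (.inr h2)
    refine .inr ?_
    have hex : ∃ i, φ (preL ω i) ≠ none := by
      push Not at h1
      exact ⟨h1.choose, h1.choose_spec.2⟩
    have hle : Nat.find hex ≤ m := by
      push Not at h1
      obtain ⟨i, hi, hi'⟩ := h1
      exact (Nat.find_min' hex hi').trans hi
    obtain ⟨y, hy⟩ := Option.ne_none_iff_exists'.1 (Nat.find_spec hex)
    have hbefore : ∀ j < Nat.find hex, φ (preL ω j) = none := fun j hj =>
      not_not.1 (Nat.find_min hex hj)
    have hpre : ∀ ω' : ℕ → α, (∀ i : Fin m, ω' i = pre ω m i) →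
        ∀ j ≤ m, preL ω' j = preL ω j := fun ω' hω' j hj =>
      List.map_congr_left fun i hi => hω' ⟨i, (List.mem_range.1 hi).trans_le hj⟩
    have hcyl : {ω' : ℕ → α | ∀ i : Fin m, ω' i = pre ω m i} ⊆ E y := fun ω' hω' =>
      ⟨Nat.find hex, by rw [hpre ω' hω' _ hle]; exact hy, fun j hj => by
        rw [hpre ω' hω' _ (hj.le.trans hle)]; exact hbefore j hj⟩
    have hQy : cylP μ (pre ω m) ≤ Q y := by
      rw [← hEQ y]
      exact measureReal_mono hcyl
    exact Set.mem_biUnion (x := y)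
      (by simpa using (not_lt.1 h2).trans hQy) ⟨Nat.find hex, hy, hbefore⟩
  have h := measureReal_mono (μ := μ) hcover
  rw [probReal_univ] at h
  have h1 := measureReal_union_le (μ := μ) ({ω | ∀ i ≤ m, φ (preL ω i) = none} ∪
      {ω | cylP μ (pre ω m) < s}) (⋃ y ∈ Finset.univ.filter (fun y => ¬ Q y < s), E y)
  have h2 := measureReal_union_le (μ := μ) {ω | ∀ i ≤ m, φ (preL ω i) = none}
      {ω | cylP μ (pre ω m) < s}
  have h3 := measureReal_biUnion_finset_le (μ := μ) (Finset.univ.filter (fun y => ¬ Q y < s)) E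
  simp only [hEQ] at h3
  have h4 := Finset.sum_filter_add_sum_filter_not Finset.univ (fun y => Q y < s) Q
  simp only [Measure.real] at h h1 h2 h3
  linarith

lemma tendsto_natFloor_mul {R : ℝ} (hR : 0 < R) :
    Tendsto (fun n : ℕ => ⌊(n : ℝ) * R⌋₊) atTop atTop :=
  tendsto_nat_floor_atTop.comp (tendsto_natCast_atTop_atTop.atTop_mul_const hR)

variable [Fintype α] [DiscreteMeasurableSpace α]
  [Fintype β] [MeasurableSpace β] [DiscreteMeasurableSpace β]
  (ν : Measure (ℕ → β)) [IsProbabilityMeasure ν]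

theorem specSup_le_of_achievable {R : ℝ} (h : Achievable μ ν R) :
    specSup ν ≤ R * specSup μ := by
  obtain ⟨hR, φ, hφ, hlim⟩ := h
  refine le_of_forall_gt_imp_ge_of_dense fun lam hlam => specSup_le ν ?_
  obtain ⟨ε, hε, hε0⟩ : ∃ ε : ℝ, (R + ε) * (specSup μ + ε) < lam ∧ 0 < ε := by
    have hc : Tendsto (fun ε : ℝ => (R + ε) * (specSup μ + ε)) (nhdsWithin 0 (Set.Ioi 0))
        (nhds ((R + 0) * (specSup μ + 0))) :=
      (Continuous.tendsto (by fun_prop) 0).mono_left nhdsWithin_le_nhds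
    exact ((hc.eventually_lt_const (by simpa using hlam)).and self_mem_nhdsWithin).exists
  have hH := specSup_nonneg μ
  have hbad := (tendsto_of_specSup_lt μ (lt_add_of_pos_right (specSup μ) hε0)).comp
    (tendsto_natFloor_mul (add_pos_of_nonneg_of_pos hR hε0))
  have hsum := hlim.add hbad
  rw [add_zero] at hsum
  refine squeeze_zero' (.of_forall fun _ => ENNReal.toReal_nonneg) ?_ hsum
  filter_upwards [eventually_ge_atTop 1] with n hn
  have hn' : (0 : ℝ) < n := by exact_mod_cast hn
  set m := ⌊(n : ℝ) * (R + ε)⌋₊ with hm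
  have hmle : (m : ℝ) ≤ n * (R + ε) := Nat.floor_le (by positivity)
  have hexp : (2 : ℝ) ^ (-((n : ℝ) * lam)) < (2 : ℝ) ^ (-((m : ℝ) * (specSup μ + ε))) := by
    refine Real.rpow_lt_rpow_of_exponent_lt one_lt_two (neg_lt_neg ?_)
    calc (m : ℝ) * (specSup μ + ε) ≤ n * (R + ε) * (specSup μ + ε) := by gcongr
      _ = n * ((R + ε) * (specSup μ + ε)) := by ring
      _ < n * lam := by gcongr
  rw [toReal_measure_pre ν (fun y : Fin n → β => cylP ν y ≤ (2 : ℝ) ^ (-((n : ℝ) * lam)))]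
  calc ∑ y : Fin n → β with cylP ν y ≤ (2 : ℝ) ^ (-((n : ℝ) * lam)), cylP ν y
      ≤ ∑ y : Fin n → β with cylP ν y < (2 : ℝ) ^ (-((m : ℝ) * (specSup μ + ε))), cylP ν y :=
        Finset.sum_le_sum_of_subset_of_nonneg
          (Finset.monotone_filter_right _ fun y _ hy => hy.trans_lt hexp)
          fun y _ _ => cylP_nonneg ν y
    _ ≤ _ := sum_lt_le_of_valid μ (sum_cylP ν n) (hφ n) m _
    _ ≤ _ := by
        refine add_le_add (toReal_mono_of_imp μ fun ω hω i hi => hω i (hi.trans ?_))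
          (toReal_mono_of_imp μ fun ω hω => hω.le)
        exact Nat.floor_mono (by gcongr; linarith)

end Algorithms

section IntervalAlgorithm

variable {α β : Type*} [Fintype α] [LinearOrder α] [MeasurableSpace α]
  [Fintype β] [LinearOrder β] [MeasurableSpace β] (μ : Measure (ℕ → α)) (ν : Measure (ℕ → β))

/-- The interval algorithm generating `Y^n`, as a full-tree function. -/
def intAlg (n : ℕ) (l : List α) : Option (Fin n → β) :=
  if h : ∃ y : Fin n → β, itv (fun x : Fin l.length → α => cylP μ x) l.get ⊆
      itv (fun y' : Fin n → β => cylP ν y') y then some h.choose else none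

lemma itv_preL_get (ω : ℕ → α) (m : ℕ) :
    itv (fun x : Fin (preL ω m).length → α => cylP μ x) (preL ω m).get =
      itv (fun x : Fin m → α => cylP μ x) (pre ω m) := by
  have hlen : (preL ω m).length = m := by simp [preL]
  have hget : (preL ω m).get = pre ω (preL ω m).length := by
    funext i
    rw [List.get_eq_getElem]
    simp [preL, pre]
  rw [hget]
  exact congrArg (fun k => itv (fun x : Fin k → α => cylP μ x) (pre ω k)) hlen

lemma itv_subset_of_intAlg_eq_some {n m : ℕ} {ω : ℕ → α} {y : Fin n → β}
    (h : intAlg μ ν n (preL ω m) = some y) :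
    itv (fun x : Fin m → α => cylP μ x) (pre ω m) ⊆
      itv (fun y' : Fin n → β => cylP ν y') y := by
  unfold intAlg at h
  split_ifs at h with hex
  rw [← itv_preL_get, ← Option.some_injective _ h]
  exact hex.choose_spec

lemma intAlg_ne_none {n m : ℕ} {ω : ℕ → α} (h : IntStopped μ ν n m ω) :
    intAlg μ ν n (preL ω m) ≠ none := by
  unfold IntStopped at h
  simp only [← itv_preL_get] at h
  unfold intAlg
  rw [dif_pos h]
  exact Option.some_ne_none _

variable [DiscreteMeasurableSpace α] [DiscreteMeasurableSpace β]
  [IsProbabilityMeasure μ] [IsProbabilityMeasure ν]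

lemma toReal_measure_not_intStopped_le (n m : ℕ) (D : Finset (Fin n → β)) {t : ℝ} (ht : 0 ≤ t) :
    (μ {ω | ¬ IntStopped μ ν n m ω}).toReal ≤
      (μ {ω | t ≤ cylP μ (pre ω m)}).toReal + ∑ y ∈ Dᶜ, cylP ν y + D.card * (2 * t) := by
  rw [toReal_measure_pre μ (fun x : Fin m → α => t ≤ cylP μ x)]
  unfold IntStopped
  rw [toReal_measure_pre μ (fun x : Fin m → α => ¬ ∃ y : Fin n → β,
    itv (fun x : Fin m → α => cylP μ x) x ⊆ itv (fun y' : Fin n → β => cylP ν y') y)]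
  exact sum_not_itv_subset_le (cylP_nonneg μ) (sum_cylP μ m) (cylP_nonneg ν) (sum_cylP ν n) D ht

lemma tendsto_not_intStopped (h : 0 < specInf μ) (n : ℕ) :
    Tendsto (fun m => (μ {ω | ¬ IntStopped μ ν n m ω}).toReal) atTop (nhds 0) := by
  obtain ⟨lam, h0, hlam⟩ := exists_between h
  have hpow : Tendsto (fun m : ℕ => (2 : ℝ) ^ (-((m : ℝ) * lam))) atTop (nhds 0) := by
    have := tendsto_rpow_neg_atTop (y := lam) h0 |>.comp
      (tendsto_pow_atTop_atTop_of_one_lt (one_lt_two (α := ℝ)))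
    refine this.congr fun m => ?_
    rw [Function.comp_apply, ← Real.rpow_natCast, ← Real.rpow_mul two_pos.le, mul_neg]
  have hlim := (tendsto_of_lt_specInf μ hlam).add
    ((hpow.const_mul 2).const_mul ((Finset.univ : Finset (Fin n → β)).card : ℝ))
  simp only [mul_zero, add_zero] at hlim
  refine squeeze_zero (fun _ => ENNReal.toReal_nonneg) (fun m => ?_) hlim
  simpa using toReal_measure_not_intStopped_le μ ν n m Finset.univ
    (t := (2 : ℝ) ^ (-((m : ℝ) * lam))) (by positivity)

theorem intAchievable_of_lt {R : ℝ} (hR : 0 < R) (h : specSup ν < R * specInf μ) :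
    IntAchievable μ ν R := by
  refine ⟨hR.le, ?_⟩
  obtain ⟨a, ha, ha'⟩ := exists_between h
  have ha0 : 0 < a := (specSup_nonneg ν).trans_lt ha
  obtain ⟨lam, hl, hl'⟩ := exists_between ((div_lt_iff₀' hR).2 ha')
  have hl0 : 0 < lam := (div_pos ha0 hR).trans hl
  rw [div_lt_iff₀' hR] at hl
  have hpow : Tendsto (fun n : ℕ => 2 * (2 : ℝ) ^ lam * ((2 : ℝ) ^ (a - R * lam)) ^ n)
      atTop (nhds (2 * (2 : ℝ) ^ lam * 0)) :=
    (tendsto_pow_atTop_nhds_zero_of_lt_one (by positivity)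
      (Real.rpow_lt_one_of_one_lt_of_neg one_lt_two (by linarith))).const_mul _
  have hlim := (((tendsto_of_lt_specInf μ hl').comp (tendsto_natFloor_mul hR)).add
    (tendsto_of_specSup_lt ν ha)).add hpow
  simp only [mul_zero, add_zero] at hlim
  refine squeeze_zero (fun _ => ENNReal.toReal_nonneg) (fun n => ?_) hlim
  set m := ⌊(n : ℝ) * R⌋₊ with hm
  set D : Finset (Fin n → β) :=
    Finset.univ.filter fun y => ¬ cylP ν y ≤ (2 : ℝ) ^ (-((n : ℝ) * a)) with hD
  refine (toReal_measure_not_intStopped_le μ ν n m D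
    (t := (2 : ℝ) ^ (-((m : ℝ) * lam))) (by positivity)).trans ?_
  refine add_le_add (add_le_add le_rfl ?_) ?_
  · rw [toReal_measure_pre ν (fun y : Fin n → β => cylP ν y ≤ (2 : ℝ) ^ (-((n : ℝ) * a)))]
    refine (Finset.sum_congr ?_ fun _ _ => rfl).le
    ext y
    simp [hD]
  · have hcard : (D.card : ℝ) ≤ (2 : ℝ) ^ ((n : ℝ) * a) := by
      have h1 : D.card • (2 : ℝ) ^ (-((n : ℝ) * a)) ≤ 1 := by
        rw [← sum_cylP ν n]
        refine (Finset.card_nsmul_le_sum D _ _ fun y hy =>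
          (not_le.1 (Finset.mem_filter.1 hy).2).le).trans ?_
        exact Finset.sum_le_sum_of_subset_of_nonneg (Finset.filter_subset _ _)
          fun y _ _ => cylP_nonneg ν y
      rwa [nsmul_eq_mul, Real.rpow_neg two_pos.le, ← div_eq_mul_inv,
        div_le_one (by positivity)] at h1
    have hfloor : (n : ℝ) * R - 1 ≤ m := (Nat.sub_one_lt_floor _).le
    calc (D.card : ℝ) * (2 * (2 : ℝ) ^ (-((m : ℝ) * lam)))
        ≤ (2 : ℝ) ^ ((n : ℝ) * a) * (2 * (2 : ℝ) ^ (-(((n : ℝ) * R - 1) * lam))) := by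
          gcongr
          exact one_le_two
      _ = 2 * (2 : ℝ) ^ lam * ((2 : ℝ) ^ (a - R * lam)) ^ n := by
          rw [← Real.rpow_mul_natCast two_pos.le, mul_left_comm, mul_assoc 2,
            ← Real.rpow_add two_pos, ← Real.rpow_add two_pos]
          congr 2
          ring


lemma itv_pre_anti (ω : ℕ → α) {m M : ℕ} (h : m ≤ M) :
    itv (fun x : Fin M → α => cylP μ x) (pre ω M) ⊆
      itv (fun x : Fin m → α => cylP μ x) (pre ω m) := by
  rw [itv_eq, itv_eq]
  refine Set.Ico_subset_Ico ?_ ?_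
  · rw [itvLo, itvLo, ← toReal_measure_pre μ (fun x => lexLt x (pre ω m)),
      ← toReal_measure_pre μ (fun x => lexLt x (pre ω M))]
    refine toReal_mono_of_imp μ fun ω' ⟨i, hi, hi'⟩ => ⟨Fin.castLE h i, fun j hj => ?_, hi'⟩
    exact hi ⟨j, lt_trans (Fin.lt_def.1 hj) i.2⟩ hj
  · rw [itvLo_add, itvLo_add,
      ← toReal_measure_pre μ (fun x => lexLt x (pre ω m) ∨ x = pre ω m),
      ← toReal_measure_pre μ (fun x => lexLt x (pre ω M) ∨ x = pre ω M)]
    refine toReal_mono_of_imp μ fun ω' hω' => ?_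
    rcases hω' with ⟨i, hi, hi'⟩ | heq
    · by_cases him : (i : ℕ) < m
      · exact .inl ⟨⟨i, him⟩, fun j hj => hi (Fin.castLE h j) hj, hi'⟩
      · exact .inr (funext fun j => hi (Fin.castLE h j)
          (Fin.lt_def.2 (j.2.trans_le (not_lt.1 him))))
    · exact .inr (funext fun j => congrFun heq (Fin.castLE h j))

theorem valid_intAlg (h : 0 < specInf μ) (n : ℕ) :
    Valid μ (fun y : Fin n → β => cylP ν y) (intAlg μ ν n) := by
  set E : (Fin n → β) → Set (ℕ → α) := fun y =>
    {ω | ∃ i : ℕ, intAlg μ ν n (preL ω i) = some y ∧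
      ∀ j < i, intAlg μ ν n (preL ω j) = none} with hE
  have hle : ∀ y, μ.real (E y) ≤ cylP ν y := by
    intro y
    set A : ℕ → Set (ℕ → α) := fun m => {ω | itv (fun x : Fin m → α => cylP μ x) (pre ω m) ⊆
      itv (fun y' : Fin n → β => cylP ν y') y} with hA
    have hmono : Monotone A := fun m M hmM ω hω => (itv_pre_anti μ ω hmM).trans hω
    have hEA : E y ⊆ ⋃ m, A m := fun ω ⟨i, hi, _⟩ =>
      Set.mem_iUnion.2 ⟨i, itv_subset_of_intAlg_eq_some μ ν hi⟩
    refine ENNReal.toReal_le_of_le_ofReal (cylP_nonneg ν y) ((measure_mono hEA).trans ?_)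
    rw [hmono.measure_iUnion]
    refine iSup_le fun m => (ENNReal.le_ofReal_iff_toReal_le (measure_ne_top μ _)
      (cylP_nonneg ν y)).2 ?_
    have hp := toReal_measure_pre μ (fun x : Fin m → α =>
      itv (fun x : Fin m → α => cylP μ x) x ⊆ itv (fun y' : Fin n → β => cylP ν y') y)
    exact hp.trans_le (sum_itv_subset_le (cylP_nonneg μ) (cylP_nonneg ν) y)
  have hbound : ∀ m, 1 ≤ (μ {ω | ¬ IntStopped μ ν n m ω}).toReal + ∑ y, μ.real (E y) := by
    intro m
    have hcover : (Set.univ : Set (ℕ → α)) ⊆ {ω | ¬ IntStopped μ ν n m ω} ∪ ⋃ y, E y := by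
      intro ω _
      by_cases hs : IntStopped μ ν n m ω
      · have hex : ∃ i, intAlg μ ν n (preL ω i) ≠ none := ⟨m, intAlg_ne_none μ ν hs⟩
        obtain ⟨y, hy⟩ := Option.ne_none_iff_exists'.1 (Nat.find_spec hex)
        exact .inr (Set.mem_iUnion.2
          ⟨y, Nat.find hex, hy, fun j hj => not_not.1 (Nat.find_min hex hj)⟩)
      · exact .inl hs
    have h1 := measureReal_mono (μ := μ) hcover
    rw [probReal_univ] at h1
    exact h1.trans ((measureReal_union_le _ _).trans
      (add_le_add le_rfl (measureReal_iUnion_fintype_le E)))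
  have hsum : 1 ≤ ∑ y, μ.real (E y) := by
    have := ge_of_tendsto' ((tendsto_not_intStopped μ ν h n).add_const (∑ y, μ.real (E y))) hbound
    simpa using this
  have heq : ∑ y, μ.real (E y) = ∑ y, cylP ν y :=
    le_antisymm (Finset.sum_le_sum fun y _ => hle y) ((sum_cylP ν n).trans_le hsum)
  exact fun y => (Finset.sum_eq_sum_iff_of_le fun y _ => hle y).1 heq y (Finset.mem_univ y)

theorem achievable_of_intAchievable (h : 0 < specInf μ) {R : ℝ} (hR : IntAchievable μ ν R) :
    Achievable μ ν R := by
  refine ⟨hR.1, intAlg μ ν, valid_intAlg μ ν h, ?_⟩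
  refine squeeze_zero (fun _ => ENNReal.toReal_nonneg) (fun n => ?_) hR.2
  exact toReal_mono_of_imp μ fun ω hω hs => intAlg_ne_none μ ν hs (hω _ le_rfl)

end IntervalAlgorithm

lemma csInf_eq_of_forall_gt_mem {S : Set ℝ} {b : ℝ} (hlb : ∀ R ∈ S, b ≤ R)
    (hmem : ∀ R, b < R → R ∈ S) : sInf S = b :=
  csInf_eq_of_forall_ge_of_forall_gt_exists_lt ⟨b + 1, hmem _ (lt_add_one b)⟩ hlb fun _ hw =>
    let ⟨c, hbc, hcw⟩ := exists_between hw
    ⟨c, hmem c hbc, hcw⟩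

end RNG

/-- **Corollary 3, coin with one-point spectrum.** If `H̄(X) = H̲(X) = H(X) > 0`, then for
any target process `ν` the interval algorithm is asymptotically optimal for the
overflow-probability criterion: `R⋆_int(X,Y) = R⋆(X,Y) = H̄(Y)/H(X)`. -/
theorem one_point_coin_spectrum_Rstar
    {𝒳 𝒴 : Type*} [Fintype 𝒳] [LinearOrder 𝒳] [MeasurableSpace 𝒳] [DiscreteMeasurableSpace 𝒳]
    [Fintype 𝒴] [LinearOrder 𝒴] [MeasurableSpace 𝒴] [DiscreteMeasurableSpace 𝒴]
    (μ : Measure (ℕ → 𝒳)) [IsProbabilityMeasure μ]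
    (ν : Measure (ℕ → 𝒴)) [IsProbabilityMeasure ν]
    (hsup : specSup μ = entRate μ) (hinf : specInf μ = entRate μ)
    (hpos : 0 < entRate μ) :
    Rint μ ν = specSup ν / entRate μ ∧ Rstar μ ν = specSup ν / entRate μ := by
  have hinf0 : 0 < specInf μ := hinf ▸ hpos
  have hlb : ∀ R, Achievable μ ν R → specSup ν / entRate μ ≤ R := fun R hR => by
    rw [div_le_iff₀ hpos, ← hsup]
    exact specSup_le_of_achievable μ ν hR
  have hmem : ∀ R, specSup ν / entRate μ < R → IntAchievable μ ν R := fun R hR =>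
    intAchievable_of_lt μ ν ((div_nonneg (specSup_nonneg ν) hpos.le).trans_lt hR)
      (by rwa [hinf, ← div_lt_iff₀ hpos])
  exact ⟨csInf_eq_of_forall_gt_mem
      (fun R hR => hlb R (achievable_of_intAchievable μ ν hinf0 hR)) hmem,
    csInf_eq_of_forall_gt_mem hlb fun R hR => achievable_of_intAchievable μ ν hinf0 (hmem R hR)⟩
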